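/- Fix α with 1 < α < 3/2, β > 0, h > 0, and c > 0 with 1 ≤ (c·2^{2−α})^{1/2}, and let the random fields be i.i.d. standard Gaussian. Then for every N ≥ 0, f_N ≥ 1 − Σ_{p=1}^{∞} (1/(β b_p)) · ( β/c + log(2 (c b_p)^{1/2}) + β h 2^{p/2} · log( 2 (c b_p)^{1/2} · (1 + √(2πe)) ) ), and this infinite series converges; evaluating it gives f_N ≥ 1 − (1/c)·2^α/(2² − 2^α) − h·[ (2−α)·2^{1/2+α}/(2^{3/2} − 2^α)² · log 2 + 2^α/(2^{3/2} − 2^α) · log(2·c^{1/2}·(1 + √(2πe))) ] − (1/β)·[ 2^α/(2² − 2^α) · log(2·c^{1/2}) + (2−α)·2^{1+α}/(2² − 2^α)² · log 2 ]. -/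

import Mathlib

open MeasureTheory ProbabilityTheory Filter
open scoped Classical

noncomputable section

/-- The spin value (±1) of a Boolean configuration entry. -/
def spin (b : Bool) : ℝ := if b then 1 else -1

/-- The total spin `S_{n,1} = Σ_i σ_i` of a configuration of `2^n` spins. -/
def totalSpin (n : ℕ) (σ : Fin (2^n) → Bool) : ℝ := ∑ i, spin (σ i)

/-- The Dyson hierarchical Hamiltonian `H_N`, defined recursively:
`H_0 = 0`, `H_{N}(σ) = H_{N-1}(σ₁) + H_{N-1}(σ₂) - 2^{-αN} Σ_{i,j} σ_i σ_j`. -/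
def dysonH (α : ℝ) : (N : ℕ) → (Fin (2^N) → Bool) → ℝ
  | 0, _ => 0
  | (N+1), σ =>
      dysonH α N (fun i => σ ⟨i.1, by have := i.2; rw [pow_succ]; omega⟩)
    + dysonH α N (fun i => σ ⟨2^N + i.1, by have := i.2; rw [pow_succ]; omega⟩)
    - (2:ℝ) ^ (-(α * ((N:ℝ)+1))) *
        ∑ i : Fin (2^(N+1)), ∑ j : Fin (2^(N+1)), spin (σ i) * spin (σ j)

/-- The random-field Hamiltonian `H_N^{RF}(σ) = H_N(σ) - h Σ_i h_i σ_i`,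
where `fh` is the field strength and `η` the realization of the random fields. -/
def dysonHRF (α fh : ℝ) (N : ℕ) (η : Fin (2^N) → ℝ) (σ : Fin (2^N) → Bool) : ℝ :=
  dysonH α N σ - fh * ∑ i, η i * spin (σ i)

/-- The Gibbs average `⟨F⟩_N` with weight `exp(-β H_N^{RF}(σ))`. -/
def gibbs (α β fh : ℝ) (N : ℕ) (η : Fin (2^N) → ℝ) (F : (Fin (2^N) → Bool) → ℝ) : ℝ :=
  (∑ σ, F σ * Real.exp (-β * dysonHRF α fh N η σ)) /
    ∑ σ, Real.exp (-β * dysonHRF α fh N η σ)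

/-- The law of `n` i.i.d. standard Gaussian random fields. -/
def gaussianFields (n : ℕ) : Measure (Fin n → ℝ) :=
  Measure.pi fun _ => gaussianReal 0 1

/-- Expectation with respect to `n` i.i.d. symmetric Bernoulli (±1) random fields,
i.e. the uniform average over `{-1,+1}^n`. -/
def bernoulliExp (n : ℕ) (F : (Fin n → ℝ) → ℝ) : ℝ :=
  ((2:ℝ)^n)⁻¹ * ∑ ε : Fin n → Bool, F (fun i => spin (ε i))

/-- `f_N = 2^{-2N} E[⟨S_{N,1}²⟩_N]` with i.i.d. standard Gaussian random fields. -/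
def fG (α β fh : ℝ) (N : ℕ) : ℝ :=
  ((2:ℝ)^(2*N))⁻¹ *
    ∫ η, gibbs α β fh N η (fun σ => (totalSpin N σ)^2) ∂ gaussianFields (2^N)

/-- `f_N = 2^{-2N} E[⟨S_{N,1}²⟩_N]` with i.i.d. symmetric Bernoulli random fields. -/
def fB (α β fh : ℝ) (N : ℕ) : ℝ :=
  ((2:ℝ)^(2*N))⁻¹ *
    bernoulliExp (2^N) (fun η => gibbs α β fh N η (fun σ => (totalSpin N σ)^2))

/-- `b_n = 2^{(2-α)n}`. -/
def bcoef (α : ℝ) (n : ℕ) : ℝ := (2:ℝ) ^ (((2:ℝ) - α) * n)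

/-- The first half `(h_1, …, h_{2^{N-1}})` of the random fields. -/
def half1 (N : ℕ) (η : Fin (2^N) → ℝ) : Fin (2^(N-1)) → ℝ :=
  fun i => η ⟨i.1, lt_of_lt_of_le i.2 (Nat.pow_le_pow_right (by norm_num) (Nat.sub_le N 1))⟩

/-- The second half `(h_{2^{N-1}+1}, …, h_{2^N})` of the random fields. -/
def half2 (N : ℕ) (η : Fin (2^N) → ℝ) : Fin (2^(N-1)) → ℝ :=
  fun i => if hlt : 2^(N-1) + i.1 < 2^N then η ⟨2^(N-1) + i.1, hlt⟩ else 0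

/-- Membership in the `k`-th of the `r` equal subintervals `I_k` of `[-2^{N-1}, 2^{N-1}]`. -/
def inBlock (N r k : ℕ) (x : ℝ) : Prop :=
  -(2:ℝ)^(N-1) + ((k:ℝ)-1) * ((2:ℝ)^N / r) ≤ x ∧
    x ≤ -(2:ℝ)^(N-1) + (k:ℝ) * ((2:ℝ)^N / r)

/-- The restricted partition function
`Z_k(η) = Σ_{σ : S_{N-1} ∈ I_k} exp(-β H_{N-1}^{RF}(σ) + 2β b_N 2^{-2N} S_{N-1}²)`,
on `2^{N-1}` spins with fields `η`. Both `Z_{k,1}` and `Z_{k,2}` are this function,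
applied to the first resp. second half of the random fields. -/
def Zres (α β fh : ℝ) (N r k : ℕ) (η : Fin (2^(N-1)) → ℝ) : ℝ :=
  ∑ σ : Fin (2^(N-1)) → Bool,
    if inBlock N r k (totalSpin (N-1) σ) then
      Real.exp (-β * dysonHRF α fh (N-1) η σ
        + 2 * β * bcoef α N * ((2:ℝ)^(2*N))⁻¹ * (totalSpin (N-1) σ)^2)
    else 0

/-- `g_k = log (Z_{k,1}(h₁) / Z_{k,2}(h₂))` as a function of all the random fields. -/
def gk (α β fh : ℝ) (N r k : ℕ) (η : Fin (2^N) → ℝ) : ℝ :=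
  Real.log (Zres α β fh N r k (half1 N η) / Zres α β fh N r k (half2 N η))

/-- `max_{1 ≤ k ≤ r} g_k`. -/
def maxgk (α β fh : ℝ) (N r : ℕ) (hr : 1 ≤ r) (η : Fin (2^N) → ℝ) : ℝ :=
  (Finset.Icc 1 r).sup' (Finset.nonempty_Icc.mpr hr) (fun k => gk α β fh N r k η)

/-- The sum of the spins in the `B`-th consecutive block of size `2^n` (out of `2^{N-n}`). -/
def blockSum (N n : ℕ) (σ : Fin (2^N) → Bool) (B : Fin (2^(N-n))) : ℝ :=
  ∑ j : Fin (2^n), if hlt : B.1 * 2^n + j.1 < 2^N then spin (σ ⟨B.1 * 2^n + j.1, hlt⟩) else 0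

/-- The generalized pressure
`P_N(v_N, …, v_1) = log Σ_σ exp(Σ_{n=1}^N v_n Σ_B (Σ_{i∈B} σ_i)² + β h Σ_i h_i σ_i)`
for a given realization `η` of the random fields; the quenched pressure is its
expectation over the fields. -/
def pressure (β fh : ℝ) (N : ℕ) (v : ℕ → ℝ) (η : Fin (2^N) → ℝ) : ℝ :=
  Real.log (∑ σ : Fin (2^N) → Bool,
    Real.exp ((∑ n ∈ Finset.Icc 1 N, v n * ∑ B : Fin (2^(N-n)), (blockSum N n σ B)^2)
      + β * fh * ∑ i, η i * spin (σ i)))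

/-- The couplings `v_n = β b_n 2^{-2n}` corresponding to `-β H_N`. -/
def vcoup (α β : ℝ) (n : ℕ) : ℝ := β * bcoef α n * ((2:ℝ)^(2*n))⁻¹

/-- `f_N = 2^{-2N} ⟨S_{N,1}²⟩_N` without random field. -/
def fNoField (α β : ℝ) (N : ℕ) : ℝ :=
  ((2:ℝ)^(2*N))⁻¹ * gibbs α β 0 N (fun _ => 0) (fun σ => (totalSpin N σ)^2)

/-- The `p`-th term of the series bounding `1 - f_N` from above. -/
def seriesTerm (α β fh c : ℝ) (p : ℕ) : ℝ :=
  (1/(β * bcoef α p)) * (β/c + Real.log (2 * Real.sqrt (c * bcoef α p))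
    + β * fh * (2:ℝ)^((p:ℝ)/2) *
      Real.log (2 * Real.sqrt (c * bcoef α p) * (1 + Real.sqrt (2*Real.pi*Real.exp 1))))

lemma aux_jensen {Ω : Type*} [Fintype Ω] [Nonempty Ω] (A B : Ω → ℝ) :
    (∑ s, B s * Real.exp (A s)) / (∑ s, Real.exp (A s)) ≤
      Real.log (∑ s, Real.exp (A s + B s)) - Real.log (∑ s, Real.exp (A s)) := by
  have hZ : 0 < ∑ s, Real.exp (A s) := Finset.sum_pos (fun _ _ => Real.exp_pos _) Finset.univ_nonempty
  set μ := (∑ s, B s * Real.exp (A s)) / (∑ s, Real.exp (A s)) with hμ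
  have h1 : Real.exp μ * ∑ s, Real.exp (A s) ≤ ∑ s, Real.exp (A s + B s) := by
    have h2 : ∑ s, Real.exp (A s) ≤ ∑ s, Real.exp (A s + B s - μ) := by
      have h3 : ∑ s, (Real.exp (A s) + (B s * Real.exp (A s) - μ * Real.exp (A s))) = ∑ s, Real.exp (A s) := by
        rw [Finset.sum_add_distrib, Finset.sum_sub_distrib, ← Finset.mul_sum, hμ]
        field_simp
        ring
      rw [← h3]
      refine Finset.sum_le_sum fun s _ => ?_
      have h4 := Real.add_one_le_exp (B s - μ)
      have : Real.exp (A s + B s - μ) = Real.exp (A s) * Real.exp (B s - μ) := by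
        rw [← Real.exp_add]; ring_nf
      rw [this]
      nlinarith [Real.exp_pos (A s)]
    calc _ ≤ Real.exp μ * ∑ s, Real.exp (A s + B s - μ) := by gcongr
      _ = _ := by
        rw [Finset.mul_sum]
        refine Finset.sum_congr rfl fun s _ => ?_
        rw [← Real.exp_add]; ring_nf
  have h5 := Real.log_le_log (by positivity) h1
  rw [Real.log_mul (Real.exp_pos _).ne' hZ.ne', Real.log_exp] at h5
  linarith

lemma aux_cs (K : Finset ℕ) (r : ℕ) (hK : K.card ≤ r) (z w : ℕ → ℝ)
    (hz : ∀ k ∈ K, 0 < z k) (hw : ∀ k ∈ K, 0 < w k) (G G' : ℝ)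
    (h1 : ∀ k ∈ K, z k / w k ≤ Real.exp G) (h2 : ∀ k ∈ K, w k / z k ≤ Real.exp G') :
    (∑ k ∈ K, z k) * (∑ k ∈ K, w k) ≤ r * (∑ k ∈ K, z k * w k) * Real.exp ((G + G') / 2) := by
  set E := Real.exp ((G + G') / 2) with hE
  have hE2 : E ^ 2 = Real.exp G * Real.exp G' := by
    rw [hE, ← Real.exp_nat_mul, ← Real.exp_add]; congr 1; push_cast; ring
  have hE0 : 0 < E := Real.exp_pos _
  have key : ∀ k ∈ K, ∀ l ∈ K, z k * w l ≤ Real.sqrt (z k * w k) * Real.sqrt (z l * w l) * E := by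
    intro k hk l hl
    have a1 := hz k hk; have a2 := hw k hk; have a3 := hz l hl; have a4 := hw l hl
    refine le_of_sq_le_sq ?_ (by positivity) 
    rw [mul_pow _ E, mul_pow (Real.sqrt _), Real.sq_sqrt (by positivity), Real.sq_sqrt (by positivity), hE2]
    have e : (z k * w l)^2 = (z k * w k * (z l * w l)) * ((z k / w k) * (w l / z l)) := by
      field_simp
    rw [e]
    gcongr
    · exact h1 k hk
    · exact h2 l hl
  rw [Finset.sum_mul_sum]
  calc _ ≤ ∑ k ∈ K, ∑ l ∈ K, Real.sqrt (z k * w k) * Real.sqrt (z l * w l) * E :=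
        Finset.sum_le_sum fun k hk => Finset.sum_le_sum fun l hl => key k hk l hl
    _ = (∑ k ∈ K, Real.sqrt (z k * w k)) ^ 2 * E := by
        rw [sq, Finset.sum_mul_sum, Finset.sum_mul]
        simp_rw [Finset.sum_mul]
    _ ≤ (K.card * ∑ k ∈ K, Real.sqrt (z k * w k) ^ 2) * E := by
        gcongr; exact sq_sum_le_card_mul_sum_sq
    _ = (K.card * ∑ k ∈ K, z k * w k) * E := by
        congr 2
        refine Finset.sum_congr rfl fun k hk => Real.sq_sqrt (mul_pos (hz k hk) (hw k hk)).le
    _ ≤ _ := by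
        have : 0 ≤ ∑ k ∈ K, z k * w k := Finset.sum_nonneg fun k hk => (mul_pos (hz k hk) (hw k hk)).le
        gcongr

/-- block partition function -/
def Zb {Ω : Type*} [Fintype Ω] (m : Ω → ℝ) (t : ℝ) (κ : Ω → ℕ) (A : Ω → ℝ) (k : ℕ) : ℝ :=
  ∑ s with κ s = k, Real.exp (A s + t / 2 * m s ^ 2)

lemma Zb_pos {Ω : Type*} [Fintype Ω] (m : Ω → ℝ) (t : ℝ) (κ : Ω → ℕ) (A : Ω → ℝ) (k : ℕ)
    (hk : k ∈ Finset.univ.image κ) : 0 < Zb m t κ A k := by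
  obtain ⟨s, _, hs⟩ := Finset.mem_image.1 hk
  exact Finset.sum_pos (fun _ _ => Real.exp_pos _) ⟨s, by simp [hs]⟩

lemma Zb_sum {Ω : Type*} [Fintype Ω] (m : Ω → ℝ) (t : ℝ) (κ : Ω → ℕ) (A : Ω → ℝ) :
    ∑ k ∈ Finset.univ.image κ, Zb m t κ A k = ∑ s, Real.exp (A s + t / 2 * m s ^ 2) := by
  unfold Zb
  exact Finset.sum_fiberwise_of_maps_to (fun s _ => Finset.mem_image_of_mem κ (Finset.mem_univ s)) _

lemma aux_W (K : Finset ℕ) (z : ℕ → ℝ) (hz : ∀ k ∈ K, 0 < z k) (L : ℝ) (hL : 0 < L) (k : ℕ) (hk : k ∈ K) :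
    z k ≤ Real.exp (L * Real.log (∑ k ∈ K, z k ^ (1 / L))) := by
  have h : z k ^ (1/L) ≤ ∑ k ∈ K, z k ^ (1 / L) :=
    Finset.single_le_sum (f := fun k => z k ^ (1/L)) (fun k hk => (Real.rpow_pos_of_pos (hz k hk) _).le) hk
  have h1 := Real.log_le_log (Real.rpow_pos_of_pos (hz k hk) _) h
  rw [Real.log_rpow (hz k hk)] at h1
  rw [← Real.log_le_iff_le_exp (hz k hk)]
  calc _ = L * (1 / L * Real.log (z k)) := by field_simp
    _ ≤ _ := by gcongr

lemma aux_log (x x0 : ℝ) (hx : 0 < x) (hx0 : 0 < x0) : Real.log x ≤ x / x0 - 1 + Real.log x0 := by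
  have := Real.log_le_sub_one_of_pos (div_pos hx hx0)
  rw [Real.log_div hx.ne' hx0.ne'] at this
  linarith

lemma aux_pw {Ω : Type*} [Fintype Ω] [Nonempty Ω] (m A1 A2 : Ω → ℝ) (t L x0 : ℝ) (ht : 0 < t)
    (hL : 0 < L) (hx0 : 0 < x0) (r : ℕ) (hr : 0 < r) (κ : Ω → ℕ) (hκ : ∀ s, κ s < r)
    (hκ2 : ∀ s u, κ s = κ u → |m s - m u| ≤ 2 / r) :
    t / 2 * ((∑ s, m s ^ 2 * Real.exp (A1 s)) / (∑ s, Real.exp (A1 s)) +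
        (∑ s, m s ^ 2 * Real.exp (A2 s)) / (∑ s, Real.exp (A2 s)))
      - t / r ^ 2 - Real.log r
      - L / 2 * ((∑ k ∈ Finset.univ.image κ, (Zb m t κ A1 k / Zb m t κ A2 k) ^ (1 / L)) / x0
        + (∑ k ∈ Finset.univ.image κ, (Zb m t κ A2 k / Zb m t κ A1 k) ^ (1 / L)) / x0
        - 2 + 2 * Real.log x0)
    ≤ t * ((∑ p : Ω × Ω, ((m p.1 + m p.2) / 2) ^ 2 *
          Real.exp (A1 p.1 + A2 p.2 + t * ((m p.1 + m p.2) / 2) ^ 2)) /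
        ∑ p : Ω × Ω, Real.exp (A1 p.1 + A2 p.2 + t * ((m p.1 + m p.2) / 2) ^ 2)) := by
  set K := Finset.univ.image κ with hKdef
  have hKc : K.card ≤ r := by
    have : K ⊆ Finset.range r := by
      intro k hk
      obtain ⟨s, _, hs⟩ := Finset.mem_image.1 hk
      exact Finset.mem_range.2 (hs ▸ hκ s)
    simpa using Finset.card_le_card this
  have hKn : K.Nonempty := Finset.univ_nonempty.image κ
  have p1 : ∀ k ∈ K, 0 < Zb m t κ A1 k := fun k hk => Zb_pos m t κ A1 k hk
  have p2 : ∀ k ∈ K, 0 < Zb m t κ A2 k := fun k hk => Zb_pos m t κ A2 k hk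
  set W1 := ∑ k ∈ K, (Zb m t κ A1 k / Zb m t κ A2 k) ^ (1 / L)
  set W2 := ∑ k ∈ K, (Zb m t κ A2 k / Zb m t κ A1 k) ^ (1 / L)
  have w1 : 0 < W1 := Finset.sum_pos (fun k hk => Real.rpow_pos_of_pos (div_pos (p1 k hk) (p2 k hk)) _) hKn
  have w2 : 0 < W2 := Finset.sum_pos (fun k hk => Real.rpow_pos_of_pos (div_pos (p2 k hk) (p1 k hk)) _) hKn
  have l1 := aux_log W1 x0 w1 hx0
  have l2 := aux_log W2 x0 w2 hx0
  have cs := aux_cs K r hKc (Zb m t κ A1) (Zb m t κ A2) p1 p2 (L * Real.log W1) (L * Real.log W2)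
    (fun k hk => aux_W K (fun k => Zb m t κ A1 k / Zb m t κ A2 k) (fun k hk => div_pos (p1 k hk) (p2 k hk)) L hL k hk)
    (fun k hk => aux_W K (fun k => Zb m t κ A2 k / Zb m t κ A1 k) (fun k hk => div_pos (p2 k hk) (p1 k hk)) L hL k hk)
  rw [Zb_sum, Zb_sum] at cs
  have j1 := aux_jensen A1 (fun s => t / 2 * m s ^ 2)
  have j2 := aux_jensen A2 (fun s => t / 2 * m s ^ 2)
  have j3 := aux_jensen (fun p : Ω × Ω => A1 p.1 + A2 p.2 + t * ((m p.1 + m p.2) / 2) ^ 2)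
    (fun p => -(t * ((m p.1 + m p.2) / 2) ^ 2))
  have e1 : ∀ A : Ω → ℝ, ∑ s, t / 2 * m s ^ 2 * Real.exp (A s) = t / 2 * ∑ s, m s ^ 2 * Real.exp (A s) := by
    intro A; rw [Finset.mul_sum]; exact Finset.sum_congr rfl fun _ _ => by ring
  rw [e1, mul_div_assoc] at j1 j2
  have e3 : ∑ p : Ω × Ω, -(t * ((m p.1 + m p.2) / 2) ^ 2) * Real.exp (A1 p.1 + A2 p.2 + t * ((m p.1 + m p.2) / 2) ^ 2)
     = -(t * ∑ p : Ω × Ω, ((m p.1 + m p.2) / 2) ^ 2 * Real.exp (A1 p.1 + A2 p.2 + t * ((m p.1 + m p.2) / 2) ^ 2)) := by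
    rw [Finset.mul_sum, ← Finset.sum_neg_distrib]; exact Finset.sum_congr rfl fun _ _ => by ring
  have e4 : ∑ p : Ω × Ω, Real.exp (A1 p.1 + A2 p.2 + t * ((m p.1 + m p.2) / 2) ^ 2 + -(t * ((m p.1 + m p.2) / 2) ^ 2))
     = (∑ s, Real.exp (A1 s)) * ∑ s, Real.exp (A2 s) := by
    rw [Fintype.sum_prod_type, Finset.sum_mul_sum]
    refine Finset.sum_congr rfl fun _ _ => Finset.sum_congr rfl fun _ _ => ?_
    rw [← Real.exp_add]; congr 1; ring
  have zp : ∀ A : Ω → ℝ, 0 < ∑ s, Real.exp (A s) := fun A => Finset.sum_pos (fun _ _ => Real.exp_pos _) Finset.univ_nonempty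
  rw [e3, e4, Real.log_mul (zp _).ne' (zp _).ne', neg_div, mul_div_assoc] at j3
  have hZ : Real.exp (-(t / r ^ 2)) * ∑ k ∈ K, Zb m t κ A1 k * Zb m t κ A2 k ≤
      ∑ p : Ω × Ω, Real.exp (A1 p.1 + A2 p.2 + t * ((m p.1 + m p.2) / 2) ^ 2) := by
    rw [Finset.mul_sum]
    calc _ ≤ ∑ k ∈ K, ∑ p : Ω × Ω with κ p.1 = k,
          Real.exp (A1 p.1 + A2 p.2 + t * ((m p.1 + m p.2) / 2) ^ 2) := by
          refine Finset.sum_le_sum fun k hk => ?_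
          unfold Zb
          rw [Finset.sum_mul_sum, ← Finset.sum_product', Finset.mul_sum]
          refine (Finset.sum_le_sum (g := fun p => Real.exp (A1 p.1 + A2 p.2 + t * ((m p.1 + m p.2) / 2) ^ 2)) ?_).trans
            (Finset.sum_le_sum_of_subset_of_nonneg ?_ fun _ _ _ => (Real.exp_pos _).le)
          · rintro ⟨s, u⟩ hsu
            simp only [Finset.mem_product, Finset.mem_filter, Finset.mem_univ, true_and] at hsu
            rw [← Real.exp_add, ← Real.exp_add]
            refine Real.exp_le_exp.2 ?_
            have h := hκ2 s u (hsu.1.trans hsu.2.symm)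
            have h2 : (m s - m u) ^ 2 ≤ (2 / r) ^ 2 := sq_le_sq' (abs_le.1 h).1 (abs_le.1 h).2
            have h3 : t * (m s - m u) ^ 2 ≤ t * (2 / r) ^ 2 := by gcongr
            have h4 : t * (2 / (r:ℝ)) ^ 2 = 4 * (t / r ^ 2) := by ring
            simp only
            nlinarith
          · rintro ⟨s, u⟩ hsu
            simp only [Finset.mem_product, Finset.mem_filter, Finset.mem_univ, true_and] at hsu ⊢
            exact hsu.1
      _ = _ := Finset.sum_fiberwise_of_maps_to
          (fun s _ => Finset.mem_image_of_mem κ (Finset.mem_univ s.1)) _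
  have hS : 0 < ∑ k ∈ K, Zb m t κ A1 k * Zb m t κ A2 k := Finset.sum_pos (fun k hk => mul_pos (p1 k hk) (p2 k hk)) hKn
  have g1 := Real.log_le_log (mul_pos (Real.exp_pos _) hS) hZ
  rw [Real.log_mul (Real.exp_pos _).ne' hS.ne', Real.log_exp] at g1
  have hr' : (0:ℝ) < r := by exact_mod_cast hr
  have g2 := Real.log_le_log (mul_pos (zp _) (zp _)) cs
  rw [Real.log_mul (mul_pos hr' hS).ne' (Real.exp_pos _).ne', Real.log_exp, Real.log_mul hr'.ne' hS.ne',
    Real.log_mul (zp _).ne' (zp _).ne'] at g2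
  have l3 : L / 2 * (Real.log W1 + Real.log W2) ≤ L / 2 * (W1 / x0 + W2 / x0 - 2 + 2 * Real.log x0) := by
    exact mul_le_mul_of_nonneg_left (by linarith) (by positivity)
  linarith

lemma aux_gauss1 (A B : ℝ → ℝ) (C a : ℝ) (hA : ∀ x, 0 < A x) (hB : ∀ x, 0 < B x)
    (iA : Integrable A (gaussianReal 0 1)) (iB : Integrable B (gaussianReal 0 1))
    (hAB : ∀ x, A x * B x ≤ C) (hLip : ∀ x y, A x ≤ Real.exp (a * |x - y|) * A y) :
    (∫ x, A x ∂gaussianReal 0 1) * (∫ x, B x ∂gaussianReal 0 1) ≤ C * Real.exp (a ^ 2) := by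
  set γ := gaussianReal 0 1 with hγ
  have hexp : ∀ b : ℝ, Integrable (fun x => Real.exp (b * x)) γ := fun b => integrable_exp_mul_gaussianReal b
  have hmgf : ∀ b : ℝ, ∫ x, Real.exp (b * x) ∂γ = Real.exp (b ^ 2 / 2) := by
    intro b
    have := mgf_gaussianReal (p := γ) (X := id) (μ := 0) (v := 1) (by simp [hγ]) b
    simpa [mgf] using this
  have e1 : ∫ p, (A p.1 * B p.2 + B p.1 * A p.2) ∂(γ.prod γ) = 2 * ((∫ x, A x ∂γ) * ∫ x, B x ∂γ) := by
    rw [integral_add (iA.mul_prod iB) (iB.mul_prod iA), integral_prod_mul, integral_prod_mul]; ring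
  have e2 : ∫ p, C * (Real.exp (a * p.1) * Real.exp (-a * p.2) + Real.exp (-a * p.1) * Real.exp (a * p.2)) ∂(γ.prod γ)
      = 2 * (C * Real.exp (a ^ 2)) := by
    rw [integral_const_mul, integral_add ((hexp a).mul_prod (hexp (-a))) ((hexp (-a)).mul_prod (hexp a)),
      integral_prod_mul (fun x => Real.exp (a * x)) (fun x => Real.exp (-a * x)),
      integral_prod_mul (fun x => Real.exp (-a * x)) (fun x => Real.exp (a * x)), hmgf, hmgf, ← Real.exp_add, ← Real.exp_add]
    ring_nf
  have h : ∫ p, (A p.1 * B p.2 + B p.1 * A p.2) ∂(γ.prod γ) ≤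
     ∫ p, C * (Real.exp (a * p.1) * Real.exp (-a * p.2) + Real.exp (-a * p.1) * Real.exp (a * p.2)) ∂(γ.prod γ) := by
    refine integral_mono ((iA.mul_prod iB).add (iB.mul_prod iA))
      ((((hexp a).mul_prod (hexp (-a))).add ((hexp (-a)).mul_prod (hexp a))).const_mul C) ?_
    rintro ⟨x, y⟩
    simp only
    rw [← Real.exp_add, ← Real.exp_add]
    have b1 : B y ≤ C / A y := by rw [le_div_iff₀ (hA y)]; linarith [hAB y]
    have b2 : B x ≤ C / A x := by rw [le_div_iff₀ (hA x)]; linarith [hAB x]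
    have hC : 0 < C := lt_of_lt_of_le (mul_pos (hA x) (hB x)) (hAB x)
    have q : A x / A y + A y / A x ≤ Real.exp (a * x + -a * y) + Real.exp (-a * x + a * y) := by
      have sym : Real.exp (a * x + -a * y) + Real.exp (-a * x + a * y) =
          Real.exp (a * |x - y|) + Real.exp (-(a * |x - y|)) := by
        rcases abs_cases (x - y) with ⟨h, _⟩ | ⟨h, _⟩ <;> rw [h]
        · congr 2 <;> ring
        · rw [add_comm]; congr 2 <;> ring
      rw [sym]
      have r1 : A x / A y ≤ Real.exp (a * |x - y|) := by
        rw [div_le_iff₀ (hA y)]; exact hLip x y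
      have r2 : A y / A x ≤ Real.exp (a * |x - y|) := by
        rw [div_le_iff₀ (hA x), abs_sub_comm]; exact hLip y x
      have r3 : A y / A x = (A x / A y)⁻¹ := (inv_div _ _).symm
      rw [r3] at r2 ⊢
      rw [Real.exp_neg]
      have hρ : 0 < A x / A y := div_pos (hA x) (hA y)
      set ρ := A x / A y
      set E := Real.exp (a * |x - y|)
      have hE : 0 < E := Real.exp_pos _
      have r4 : 1 ≤ E * ρ := by
        rw [inv_le_comm₀ hρ hE] at r2
        rwa [inv_le_iff_one_le_mul₀' hE] at r2
      have : E + E⁻¹ - (ρ + ρ⁻¹) = (E - ρ) * (E * ρ - 1) / (E * ρ) := by field_simp; ring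
      have : 0 ≤ E + E⁻¹ - (ρ + ρ⁻¹) := by
        rw [this]; apply div_nonneg (mul_nonneg _ _) (by positivity) <;> linarith
      linarith
    calc A x * B y + B x * A y ≤ A x * (C / A y) + (C / A x) * A y := by
          have := (hA x).le; have := (hA y).le; gcongr
      _ = C * (A x / A y + A y / A x) := by ring
      _ ≤ _ := by gcongr
  rw [e1, e2] at h
  linarith

lemma aux_int (n : ℕ) (G : (Fin n → ℝ) → ℝ) (a : ℝ) (hm : Measurable G) (hG : ∀ x, 0 < G x)
    (hLip : ∀ x y, G x ≤ Real.exp (a * ∑ i, |x i - y i|) * G y) :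
    Integrable G (Measure.pi fun _ : Fin n => gaussianReal 0 1) := by
  have h1 : Integrable (fun x : Fin n → ℝ => ∏ i, (Real.exp (a * |x i|))) (Measure.pi fun _ : Fin n => gaussianReal 0 1) := by
    refine Integrable.fintype_prod (f := fun _ x => Real.exp (a * |x|)) fun i => ?_
    refine ((integrable_exp_mul_gaussianReal (μ := 0) (v := 1) a).add (integrable_exp_mul_gaussianReal (μ := 0) (v := 1) (-a))).mono'
      (by fun_prop) (ae_of_all _ fun x => ?_)
    rw [Real.norm_of_nonneg (Real.exp_pos _).le]
    simp only [Pi.add_apply]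
    rcases abs_cases x with ⟨h, _⟩ | ⟨h, _⟩ <;> rw [h]
    · linarith [Real.exp_pos (-a * x)]
    · rw [mul_neg, neg_mul]; linarith [Real.exp_pos (a * x)]
  refine (h1.mul_const (G 0)).mono' hm.aestronglyMeasurable (ae_of_all _ fun x => ?_)
  rw [Real.norm_of_nonneg (hG x).le, ← Real.exp_sum, ← Finset.mul_sum]
  simpa using hLip x 0

lemma aux_gauss (n : ℕ) (G : (Fin n → ℝ) → ℝ) (a : ℝ) (hm : Measurable G) (hG : ∀ x, 0 < G x)
    (hLip : ∀ x y, G x ≤ Real.exp (a * ∑ i, |x i - y i|) * G y) :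
    (∫ x, G x ∂(Measure.pi fun _ : Fin n => gaussianReal 0 1)) *
      (∫ x, (G x)⁻¹ ∂(Measure.pi fun _ : Fin n => gaussianReal 0 1)) ≤ Real.exp (n * a ^ 2) := by
  induction n with
  | zero =>
    have h : ∀ x : Fin 0 → ℝ, G x = G 0 := fun x => by rw [Subsingleton.elim x 0]
    simp_rw [h]
    simp [mul_inv_cancel₀ (hG _).ne']
  | succ n ih =>
    have hLip' : ∀ x y, (G x)⁻¹ ≤ Real.exp (a * ∑ i, |x i - y i|) * (G y)⁻¹ := by
      intro x y
      have h := hLip y x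
      simp_rw [abs_sub_comm (y _) (x _)] at h
      rw [← div_eq_mul_inv, le_div_iff₀ (hG y), inv_mul_le_iff₀ (hG x)]
      linarith
    have iG := aux_int _ G a hm hG hLip
    have iG' := aux_int _ (fun x => (G x)⁻¹) a hm.inv (fun x => inv_pos.2 (hG x)) hLip'
    set π := (Measure.pi fun _ : Fin n => gaussianReal 0 1) with hπ
    have mp := (measurePreserving_piFinSuccAbove (fun _ : Fin (n+1) => gaussianReal 0 1) 0).symm
    have hcons : ⇑(MeasurableEquiv.piFinSuccAbove (fun _ : Fin (n+1) => ℝ) 0).symm =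
        fun p : ℝ × (Fin n → ℝ) => (Fin.cons p.1 p.2 : Fin (n+1) → ℝ) := by
      funext p
      simp [MeasurableEquiv.piFinSuccAbove, Fin.insertNthEquiv]
    have key : ∀ F : (Fin (n+1) → ℝ) → ℝ, Integrable F (Measure.pi fun _ : Fin (n+1) => gaussianReal 0 1) →
        Integrable (fun p : ℝ × (Fin n → ℝ) => F (Fin.cons p.1 p.2)) ((gaussianReal 0 1).prod π) ∧
        ∫ x, F x ∂(Measure.pi fun _ : Fin (n+1) => gaussianReal 0 1) =
          ∫ x, ∫ y, F (Fin.cons x y) ∂π ∂(gaussianReal 0 1) := by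
      intro F hF
      have h0 := (mp.integrable_comp_emb (MeasurableEquiv.measurableEmbedding _)).2 hF
      rw [hcons] at h0
      have h1 : Integrable (fun p : ℝ × (Fin n → ℝ) => F (Fin.cons p.1 p.2)) ((gaussianReal 0 1).prod π) :=
        h0
      refine ⟨h1, ?_⟩
      rw [← mp.integral_comp (MeasurableEquiv.measurableEmbedding _) F, ← integral_prod _ h1]
      rw [hcons]
    obtain ⟨j1, k1⟩ := key G iG
    obtain ⟨j2, k2⟩ := key _ iG'
    rw [k1, k2]
    have mc : ∀ x : ℝ, Measurable (fun y : Fin n → ℝ => (Fin.cons x y : Fin (n+1) → ℝ)) := by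
      intro x
      refine measurable_pi_iff.2 fun i => ?_
      refine Fin.cases ?_ (fun i => ?_) i
      · simp
      · simpa using measurable_pi_apply i
    have lc : ∀ x (y y' : Fin n → ℝ), G (Fin.cons x y) ≤ Real.exp (a * ∑ i, |y i - y' i|) * G (Fin.cons x y') := by
      intro x y y'
      simpa [Fin.sum_univ_succ] using hLip (Fin.cons x y) (Fin.cons x y')
    have lc' : ∀ x (y y' : Fin n → ℝ), (G (Fin.cons x y))⁻¹ ≤ Real.exp (a * ∑ i, |y i - y' i|) * (G (Fin.cons x y'))⁻¹ := by
      intro x y y'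
      simpa [Fin.sum_univ_succ] using hLip' (Fin.cons x y) (Fin.cons x y')
    have s1 : ∀ x, Integrable (fun y => G (Fin.cons x y)) π := fun x =>
      aux_int n _ a (hm.comp (mc x)) (fun _ => hG _) (lc x)
    have s2 : ∀ x, Integrable (fun y => (G (Fin.cons x y))⁻¹) π := fun x =>
      aux_int n _ a (hm.comp (mc x)).inv (fun _ => inv_pos.2 (hG _)) (lc' x)
    have pos : ∀ F : (Fin n → ℝ) → ℝ, Integrable F π → (∀ y, 0 < F y) → 0 < ∫ y, F y ∂π := by
      intro F iF hF
      rw [integral_pos_iff_support_of_nonneg (fun y => (hF y).le) iF]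
      have : Function.support F = Set.univ := by ext y; simp [(hF y).ne']
      rw [this]; simp
    have := aux_gauss1 (fun x => ∫ y, G (Fin.cons x y) ∂π) (fun x => ∫ y, (G (Fin.cons x y))⁻¹ ∂π)
      (Real.exp (n * a ^ 2)) a (fun x => pos _ (s1 x) fun _ => hG _) (fun x => pos _ (s2 x) fun _ => inv_pos.2 (hG _))
      j1.integral_prod_left j2.integral_prod_left
      (fun x => ih (fun y => G (Fin.cons x y)) (hm.comp (mc x)) (fun _ => hG _) (lc x))
      (fun x x' => by
        rw [← integral_const_mul]
        refine integral_mono (s1 x) ((s1 x').const_mul _) fun y => ?_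
        simpa [Fin.sum_univ_succ] using hLip (Fin.cons x y) (Fin.cons x' y))
    refine this.trans (le_of_eq ?_)
    rw [← Real.exp_add]; push_cast; ring_nf

/-- splitting the index set in two halves -/
def eN (N : ℕ) : Fin (2^N) ⊕ Fin (2^N) ≃ Fin (2^(N+1)) :=
  finSumFinEquiv.trans (finCongr (by rw [pow_succ]; omega))

/-- first half -/
def hf1 {X : Type*} (N : ℕ) (σ : Fin (2^(N+1)) → X) : Fin (2^N) → X := fun i => σ (eN N (Sum.inl i))
/-- second half -/
def hf2 {X : Type*} (N : ℕ) (σ : Fin (2^(N+1)) → X) : Fin (2^N) → X := fun i => σ (eN N (Sum.inr i))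

lemma aux_sum (N : ℕ) (F : Fin (2^(N+1)) → ℝ) :
    ∑ i, F i = ∑ i, hf1 N F i + ∑ i, hf2 N F i := by
  rw [← (eN N).sum_comp, Fintype.sum_sum_type]; rfl

lemma aux_spin (N : ℕ) (σ : Fin (2^(N+1)) → Bool) :
    totalSpin (N+1) σ = totalSpin N (hf1 N σ) + totalSpin N (hf2 N σ) := by
  unfold totalSpin; rw [aux_sum]; rfl

lemma aux_H (α fh : ℝ) (N : ℕ) (η : Fin (2^(N+1)) → ℝ) (σ : Fin (2^(N+1)) → Bool) :
    dysonHRF α fh (N+1) η σ = dysonHRF α fh N (hf1 N η) (hf1 N σ) + dysonHRF α fh N (hf2 N η) (hf2 N σ)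
      - (2:ℝ) ^ (-(α * ((N:ℝ)+1))) * (totalSpin (N+1) σ) ^ 2 := by
  unfold dysonHRF
  rw [aux_sum, dysonH, ← Finset.sum_mul_sum, ← sq]
  have h1 : (fun i : Fin (2^N) => σ ⟨i.1, by have := i.2; rw [pow_succ]; omega⟩) = hf1 N σ := by
    funext i; unfold hf1; congr 1
  have h2 : (fun i : Fin (2^N) => σ ⟨2^N + i.1, by have := i.2; rw [pow_succ]; omega⟩) = hf2 N σ := by
    funext i; unfold hf2; congr 1
  rw [h1, h2]
  simp only [totalSpin, hf1, hf2]
  ring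

/-- configurations split -/
def cfgE (N : ℕ) : (Fin (2^(N+1)) → Bool) ≃ (Fin (2^N) → Bool) × (Fin (2^N) → Bool) :=
  (Equiv.arrowCongr (eN N).symm (Equiv.refl Bool)).trans (Equiv.sumArrowEquivProdArrow _ _ _)

lemma cfgE_apply (N : ℕ) (σ) : cfgE N σ = (hf1 N σ, hf2 N σ) := rfl

/-- magnetization density -/
def mag (N : ℕ) (σ : Fin (2^N) → Bool) : ℝ := totalSpin N σ / 2^N

/-- local normalized second moment -/
def phi (α β fh : ℝ) (N : ℕ) (η : Fin (2^N) → ℝ) : ℝ :=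
  (∑ s, mag N s ^ 2 * Real.exp (-β * dysonHRF α fh N η s)) / ∑ s, Real.exp (-β * dysonHRF α fh N η s)

lemma fG_eq (α β fh : ℝ) (N : ℕ) : fG α β fh N = ∫ η, phi α β fh N η ∂gaussianFields (2^N) := by
  unfold fG
  rw [← integral_const_mul]
  congr 1; funext η
  unfold gibbs phi mag
  rw [← mul_div_assoc, Finset.mul_sum]
  congr 1
  refine Finset.sum_congr rfl fun s _ => ?_
  rw [div_pow, pow_mul']; ring

lemma phi_split (α β fh : ℝ) (N : ℕ) (η : Fin (2^(N+1)) → ℝ) (t : ℝ) (ht : t = β * bcoef α (N+1)) :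
    phi α β fh (N+1) η =
     (∑ p : (Fin (2^N) → Bool) × (Fin (2^N) → Bool), ((mag N p.1 + mag N p.2) / 2) ^ 2 *
          Real.exp (-β * dysonHRF α fh N (hf1 N η) p.1 + -β * dysonHRF α fh N (hf2 N η) p.2 + t * ((mag N p.1 + mag N p.2) / 2) ^ 2)) /
        ∑ p : (Fin (2^N) → Bool) × (Fin (2^N) → Bool), Real.exp (-β * dysonHRF α fh N (hf1 N η) p.1 + -β * dysonHRF α fh N (hf2 N η) p.2 + t * ((mag N p.1 + mag N p.2) / 2) ^ 2) := by
  have hm : ∀ σ, mag (N+1) σ = (mag N (hf1 N σ) + mag N (hf2 N σ)) / 2 := by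
    intro σ; unfold mag; rw [aux_spin, pow_succ]; field_simp
  have hb : t * (1 / 2^(N+1)) ^ 2 = β * (2:ℝ) ^ (-(α * ((N:ℝ)+1))) := by
    rw [ht, bcoef, mul_assoc]
    congr 1
    have : ((1:ℝ) / 2^(N+1)) ^ 2 = (2:ℝ) ^ (-(2 * ((N:ℝ)+1))) := by
      rw [Real.rpow_neg (by norm_num), one_div, inv_pow, ← pow_mul, ← Real.rpow_natCast]
      push_cast; ring_nf
    rw [this, ← Real.rpow_add (by norm_num)]
    push_cast; ring_nf
  have hw : ∀ σ, -β * dysonHRF α fh (N+1) η σ = -β * dysonHRF α fh N (hf1 N η) (hf1 N σ) + -β * dysonHRF α fh N (hf2 N η) (hf2 N σ)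
      + t * ((mag N (hf1 N σ) + mag N (hf2 N σ)) / 2) ^ 2 := by
    intro σ
    rw [← hm, aux_H, mag]
    have : t * (totalSpin (N+1) σ / 2^(N+1)) ^ 2 = t * (1 / 2^(N+1)) ^ 2 * totalSpin (N+1) σ ^ 2 := by ring
    rw [this, hb]; ring
  unfold phi
  congr 1
  · refine Fintype.sum_equiv (cfgE N) _ _ fun σ => ?_
    rw [hw, hm, cfgE_apply]
  · refine Fintype.sum_equiv (cfgE N) _ _ fun σ => ?_
    rw [hw, cfgE_apply]

lemma mp_split (N : ℕ) : MeasurePreserving (fun η : Fin (2^(N+1)) → ℝ => (hf1 N η, hf2 N η))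
    (gaussianFields (2^(N+1))) ((gaussianFields (2^N)).prod (gaussianFields (2^N))) := by
  have h1 := (measurePreserving_piCongrLeft (α := fun _ => ℝ) (fun _ : Fin (2^(N+1)) => gaussianReal 0 1) (eN N)).symm
  have h2 := measurePreserving_sumPiEquivProdPi (X := fun _ : Fin (2^N) ⊕ Fin (2^N) => ℝ) (fun _ => gaussianReal 0 1)
  exact h2.comp h1

lemma mag_abs (N : ℕ) (s) : |mag N s| ≤ 1 := by
  unfold mag totalSpin
  rw [abs_div, abs_of_pos (by positivity : (0:ℝ) < 2^N), div_le_one (by positivity)]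
  refine (Finset.abs_sum_le_sum_abs _ _).trans ?_
  have : ∀ b, |spin b| = 1 := by intro b; unfold spin; split_ifs <;> simp
  simp [this]

lemma phi_meas (α β fh : ℝ) (N : ℕ) : Measurable (phi α β fh N) := by
  unfold phi dysonHRF
  fun_prop

instance (n : ℕ) : IsProbabilityMeasure (gaussianFields n) := by
  unfold gaussianFields; infer_instance

lemma phi_int (α β fh : ℝ) (N : ℕ) : Integrable (phi α β fh N) (gaussianFields (2^N)) := by
  refine Integrable.of_bound (phi_meas α β fh N).aestronglyMeasurable 1 (ae_of_all _ fun η => ?_)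
  have hZ : 0 < ∑ s, Real.exp (-β * dysonHRF α fh N η s) := Finset.sum_pos (fun _ _ => Real.exp_pos _) Finset.univ_nonempty
  unfold phi
  rw [Real.norm_of_nonneg (by positivity), div_le_one hZ]
  refine Finset.sum_le_sum fun s _ => ?_
  have := (sq_le_one_iff_abs_le_one _).2 (mag_abs N s)
  nlinarith [Real.exp_pos (-β * dysonHRF α fh N η s)]

/-- block index -/
def kap (N r : ℕ) (s : Fin (2^N) → Bool) : ℕ := min ⌊(mag N s + 1) * r / 2⌋₊ (r - 1)

lemma kap_lt (N r : ℕ) (hr : 0 < r) (s) : kap N r s < r := by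
  unfold kap; omega

lemma kap_bd (N r : ℕ) (hr : 0 < r) (s) :
    (kap N r s : ℝ) ≤ (mag N s + 1) * r / 2 ∧ (mag N s + 1) * r / 2 ≤ kap N r s + 1 := by
  have hr' : (0:ℝ) < r := by exact_mod_cast hr
  obtain ⟨h1, h2⟩ := abs_le.1 (mag_abs N s)
  have hu : 0 ≤ (mag N s + 1) * r / 2 := by
    have : 0 ≤ mag N s + 1 := by linarith
    positivity
  have hu2 : (mag N s + 1) * r / 2 ≤ r := by nlinarith
  unfold kap
  constructor
  · refine le_trans ?_ (Nat.floor_le hu)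
    exact_mod_cast min_le_left _ _
  · rcases min_choice ⌊(mag N s + 1) * r / 2⌋₊ (r - 1) with h | h <;> rw [h]
    · exact (Nat.lt_floor_add_one _).le
    · refine hu2.trans ?_
      rw [Nat.cast_sub hr]; simp

lemma kap_close (N r : ℕ) (hr : 0 < r) (s u) (h : kap N r s = kap N r u) : |mag N s - mag N u| ≤ 2 / r := by
  have hr' : (0:ℝ) < r := by exact_mod_cast hr
  obtain ⟨a1, a2⟩ := kap_bd N r hr s
  obtain ⟨b1, b2⟩ := kap_bd N r hr u
  rw [h] at a1 a2
  have e : |mag N s - mag N u| * r = |(mag N s - mag N u) * r| := by rw [abs_mul, abs_of_pos hr']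
  rw [le_div_iff₀ hr', e, abs_le]
  constructor <;> linarith

lemma Zb_lip (α β fh t : ℝ) (hβ : 0 < β) (hfh : 0 < fh) (N : ℕ) (κ : (Fin (2^N) → Bool) → ℕ) (k : ℕ) (x y : Fin (2^N) → ℝ) :
    Zb (mag N) t κ (fun s => -β * dysonHRF α fh N x s) k ≤
      Real.exp (β * fh * ∑ i, |x i - y i|) * Zb (mag N) t κ (fun s => -β * dysonHRF α fh N y s) k := by
  unfold Zb
  rw [Finset.mul_sum]
  refine Finset.sum_le_sum fun s _ => ?_
  rw [← Real.exp_add, Real.exp_le_exp]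
  unfold dysonHRF
  have h : ∑ i, x i * spin (s i) ≤ ∑ i, |x i - y i| + ∑ i, y i * spin (s i) := by
    rw [← Finset.sum_add_distrib]
    refine Finset.sum_le_sum fun i _ => ?_
    unfold spin
    split_ifs <;> linarith [le_abs_self (x i - y i), neg_abs_le (x i - y i)]
  have := mul_le_mul_of_nonneg_left h (mul_pos hβ hfh).le
  linarith

lemma Zb_meas (α β fh t : ℝ) (N : ℕ) (κ : (Fin (2^N) → Bool) → ℕ) (k : ℕ) :
    Measurable (fun x : Fin (2^N) → ℝ => Zb (mag N) t κ (fun s => -β * dysonHRF α fh N x s) k) := by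
  unfold Zb dysonHRF
  fun_prop

lemma W_bound (α β fh t L : ℝ) (hβ : 0 < β) (hfh : 0 < fh) (N : ℕ) (hL : L = β * fh * (2:ℝ) ^ (((N+1 : ℕ):ℝ)/2))
    (κ : (Fin (2^N) → Bool) → ℕ) (k : ℕ) (hk : k ∈ Finset.univ.image κ) :
    let G : (Fin (2^N) → ℝ) → ℝ := fun x => Zb (mag N) t κ (fun s => -β * dysonHRF α fh N x s) k ^ (1 / L)
    (∀ x y, (Zb (mag N) t κ (fun s => -β * dysonHRF α fh N x s) k / Zb (mag N) t κ (fun s => -β * dysonHRF α fh N y s) k) ^ (1 / L)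
      = G x * (G y)⁻¹) ∧
    Integrable G (gaussianFields (2^N)) ∧ Integrable (fun x => (G x)⁻¹) (gaussianFields (2^N)) ∧
    (∫ x, G x ∂(gaussianFields (2^N))) * (∫ x, (G x)⁻¹ ∂(gaussianFields (2^N))) ≤ Real.exp (1/2) := by
  intro G
  have hLp : 0 < L := by rw [hL]; positivity
  have hZ : ∀ x, 0 < Zb (mag N) t κ (fun s => -β * dysonHRF α fh N x s) k := fun x => Zb_pos _ _ _ _ _ hk
  have hG : ∀ x, 0 < G x := fun x => Real.rpow_pos_of_pos (hZ x) _
  have hm : Measurable G := (Zb_meas α β fh t N κ k).pow_const _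
  have hLip : ∀ x y, G x ≤ Real.exp ((β * fh / L) * ∑ i, |x i - y i|) * G y := by
    intro x y
    have h := Real.rpow_le_rpow (hZ x).le (Zb_lip α β fh t hβ hfh N κ k x y) (one_div_pos.2 hLp).le
    rw [Real.mul_rpow (Real.exp_pos _).le (hZ y).le, ← Real.exp_mul] at h
    refine h.trans (le_of_eq ?_)
    congr 2; ring
  have hLip' : ∀ x y, (G x)⁻¹ ≤ Real.exp ((β * fh / L) * ∑ i, |x i - y i|) * (G y)⁻¹ := by
    intro x y
    have h := hLip y x
    simp_rw [abs_sub_comm (y _) (x _)] at h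
    rw [← div_eq_mul_inv, le_div_iff₀ (hG y), inv_mul_le_iff₀ (hG x)]
    linarith
  refine ⟨fun x y => ?_, aux_int _ G _ hm hG hLip, aux_int _ _ _ hm.inv (fun x => inv_pos.2 (hG x)) hLip', ?_⟩
  · rw [Real.div_rpow (hZ x).le (hZ y).le, div_eq_mul_inv]
  · refine (aux_gauss _ G _ hm hG hLip).trans (le_of_eq ?_)
    congr 1
    have h2 : ((2:ℝ) ^ (((N+1 : ℕ):ℝ)/2)) ^ 2 = 2 ^ (N+1) := by
      rw [← Real.rpow_natCast, ← Real.rpow_mul (by norm_num), ← Real.rpow_natCast]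
      congr 1; push_cast; ring
    rw [hL, div_mul_eq_div_div, div_self (mul_pos hβ hfh).ne', div_pow, h2, pow_succ]
    push_cast
    field_simp
    ring

lemma aux_step (α β fh : ℝ) (hβ : 0 < β) (hfh : 0 < fh) (N r : ℕ) (hr : 0 < r) :
    fG α β fh N - (1 / (β * bcoef α (N+1))) * (β * bcoef α (N+1) / r ^ 2 + Real.log r
      + β * fh * (2:ℝ) ^ (((N+1 : ℕ):ℝ)/2) * Real.log (r * Real.exp (1/2))) ≤ fG α β fh (N+1) := by
  have hr' : (0:ℝ) < r := by exact_mod_cast hr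
  set t := β * bcoef α (N+1) with ht
  have htp : 0 < t := by rw [ht, bcoef]; positivity
  set L := β * fh * (2:ℝ) ^ (((N+1 : ℕ):ℝ)/2) with hL
  have hLp : 0 < L := by rw [hL]; positivity
  set x0 := r * Real.exp (1/2) with hx0
  have hx0p : 0 < x0 := by positivity
  set κ := kap N r
  set K := Finset.univ.image κ
  have hKc : K.card ≤ r := by
    have : K ⊆ Finset.range r := by
      intro k hk
      obtain ⟨s, _, hs⟩ := Finset.mem_image.1 hk
      exact Finset.mem_range.2 (hs ▸ kap_lt N r hr s)
    simpa using Finset.card_le_card this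
  set γ := gaussianFields (2^N)
  let G : ℕ → (Fin (2^N) → ℝ) → ℝ := fun k x => Zb (mag N) t κ (fun s => -β * dysonHRF α fh N x s) k ^ (1 / L)
  let W1 : (Fin (2^N) → ℝ) × (Fin (2^N) → ℝ) → ℝ := fun p => ∑ k ∈ K, G k p.1 * (G k p.2)⁻¹
  let W2 : (Fin (2^N) → ℝ) × (Fin (2^N) → ℝ) → ℝ := fun p => ∑ k ∈ K, (G k p.1)⁻¹ * G k p.2
  have hWb := fun k hk => W_bound α β fh t L hβ hfh N hL κ k hk
  have iW1 : Integrable W1 (γ.prod γ) :=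
    integrable_finsetSum _ fun k hk => (hWb k hk).2.1.mul_prod (hWb k hk).2.2.1
  have iW2 : Integrable W2 (γ.prod γ) :=
    integrable_finsetSum _ fun k hk => (hWb k hk).2.2.1.mul_prod (hWb k hk).2.1
  have cardb : ∑ k ∈ K, Real.exp (1/2) ≤ x0 := by
    rw [Finset.sum_const, nsmul_eq_mul, hx0]
    gcongr
  have bW1 : ∫ p, W1 p ∂(γ.prod γ) ≤ x0 := by
    rw [integral_finsetSum _ fun k hk => (hWb k hk).2.1.mul_prod (hWb k hk).2.2.1]
    refine (Finset.sum_le_sum fun k hk => ?_).trans cardb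
    rw [integral_prod_mul (G k) (fun y => (G k y)⁻¹)]
    exact (hWb k hk).2.2.2
  have bW2 : ∫ p, W2 p ∂(γ.prod γ) ≤ x0 := by
    rw [integral_finsetSum _ fun k hk => (hWb k hk).2.2.1.mul_prod (hWb k hk).2.1]
    refine (Finset.sum_le_sum fun k hk => ?_).trans cardb
    rw [integral_prod_mul (fun y => (G k y)⁻¹) (G k), mul_comm]
    exact (hWb k hk).2.2.2
  let R : (Fin (2^N) → ℝ) × (Fin (2^N) → ℝ) → ℝ := fun p =>
    (t / 2 * (phi α β fh N p.1 + phi α β fh N p.2) - L / 2 / x0 * (W1 p + W2 p)) +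
      (- (t / r ^ 2) - Real.log r - L / 2 * (-2 + 2 * Real.log x0))
  have hpw : ∀ η : Fin (2^(N+1)) → ℝ, R (hf1 N η, hf2 N η) ≤ t * phi α β fh (N+1) η := by
    intro η
    rw [phi_split α β fh N η t ht]
    refine le_trans (le_of_eq ?_) (aux_pw (mag N) (fun s => -β * dysonHRF α fh N (hf1 N η) s)
      (fun s => -β * dysonHRF α fh N (hf2 N η) s) t L x0 htp hLp hx0p r hr κ (kap_lt N r hr) (kap_close N r hr))
    have q1 : ∑ k ∈ K, (Zb (mag N) t κ (fun s => -β * dysonHRF α fh N (hf1 N η) s) k /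
        Zb (mag N) t κ (fun s => -β * dysonHRF α fh N (hf2 N η) s) k) ^ (1 / L) = W1 (hf1 N η, hf2 N η) :=
      Finset.sum_congr rfl fun k hk => (hWb k hk).1 _ _
    have q2 : ∑ k ∈ K, (Zb (mag N) t κ (fun s => -β * dysonHRF α fh N (hf2 N η) s) k /
        Zb (mag N) t κ (fun s => -β * dysonHRF α fh N (hf1 N η) s) k) ^ (1 / L) = W2 (hf1 N η, hf2 N η) :=
      Finset.sum_congr rfl fun k hk => ((hWb k hk).1 _ _).trans (mul_comm _ _)
    rw [q1, q2]
    simp only [R, phi]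
    ring
  have ip := phi_int α β fh N
  have ip1 : Integrable (fun p : (Fin (2^N) → ℝ) × (Fin (2^N) → ℝ) => phi α β fh N p.1) (γ.prod γ) := ip.comp_fst γ
  have ip2 : Integrable (fun p : (Fin (2^N) → ℝ) × (Fin (2^N) → ℝ) => phi α β fh N p.2) (γ.prod γ) := ip.comp_snd γ
  have iR0 : Integrable (fun p => t / 2 * (phi α β fh N p.1 + phi α β fh N p.2) - L / 2 / x0 * (W1 p + W2 p)) (γ.prod γ) :=
    ((ip1.add ip2).const_mul _).sub ((iW1.add iW2).const_mul _)
  have iR : Integrable R (γ.prod γ) := iR0.add (integrable_const _)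
  have e1 : ∫ p, phi α β fh N p.1 ∂(γ.prod γ) = fG α β fh N := by
    rw [integral_fun_fst, fG_eq]; simp [γ]
  have e2 : ∫ p, phi α β fh N p.2 ∂(γ.prod γ) = fG α β fh N := by
    rw [integral_fun_snd, fG_eq]; simp [γ]
  have eR : ∫ p, R p ∂(γ.prod γ) = (t / 2 * (fG α β fh N + fG α β fh N) - L / 2 / x0 * (∫ p, W1 p ∂(γ.prod γ) + ∫ p, W2 p ∂(γ.prod γ))) +
      (- (t / r ^ 2) - Real.log r - L / 2 * (-2 + 2 * Real.log x0)) := by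
    simp only [R]
    have c1 : Integrable (fun p : (Fin (2^N) → ℝ) × (Fin (2^N) → ℝ) => t / 2 * (phi α β fh N p.1 + phi α β fh N p.2)) (γ.prod γ) :=
      (ip1.add ip2).const_mul _
    have c2 : Integrable (fun p => L / 2 / x0 * (W1 p + W2 p)) (γ.prod γ) := (iW1.add iW2).const_mul _
    rw [integral_add iR0 (integrable_const _), integral_sub c1 c2,
      integral_const_mul, integral_const_mul, integral_add ip1 ip2, integral_add iW1 iW2, e1, e2]
    simp
  have mp := mp_split N
  have eT : ∫ η, R (hf1 N η, hf2 N η) ∂gaussianFields (2^(N+1)) = ∫ p, R p ∂(γ.prod γ) := by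
    rw [← mp.map_eq, integral_map mp.measurable.aemeasurable (by rw [mp.map_eq]; exact iR.aestronglyMeasurable)]
  have main : ∫ η, R (hf1 N η, hf2 N η) ∂gaussianFields (2^(N+1)) ≤ ∫ η, t * phi α β fh (N+1) η ∂gaussianFields (2^(N+1)) :=
    integral_mono (mp.integrable_comp_of_integrable iR) ((phi_int α β fh (N+1)).const_mul t) hpw
  rw [eT, eR, integral_const_mul, ← fG_eq] at main
  have hW : L / 2 / x0 * (∫ p, W1 p ∂(γ.prod γ) + ∫ p, W2 p ∂(γ.prod γ)) ≤ L := by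
    calc _ ≤ L / 2 / x0 * (x0 + x0) := by gcongr
      _ = L := by field_simp; ring
  have fin : t * fG α β fh N - (t / r ^ 2 + Real.log r + L * Real.log x0) ≤ t * fG α β fh (N+1) := by linarith
  have : fG α β fh N - (1 / t) * (t / r ^ 2 + Real.log r + L * Real.log x0) = (t * fG α β fh N - (t / r ^ 2 + Real.log r + L * Real.log x0)) / t := by
    field_simp
  rw [this, div_le_iff₀ htp]
  linarith

lemma b_ge (α c : ℝ) (hα2 : α < 3/2) (hc : 0 < c)
    (hc1 : 1 ≤ Real.sqrt (c * (2:ℝ)^((2:ℝ) - α))) (p : ℕ) : 1 ≤ Real.sqrt (c * bcoef α (p+1)) := by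
  refine hc1.trans (Real.sqrt_le_sqrt ?_)
  unfold bcoef
  gcongr
  · norm_num
  · push_cast; nlinarith [(Nat.cast_nonneg p : (0:ℝ) ≤ p)]

lemma exp_half_le : Real.exp (1/2) ≤ 1 + Real.sqrt (2 * Real.pi * Real.exp 1) := by
  have : Real.exp (1/2) ≤ Real.sqrt (2 * Real.pi * Real.exp 1) := by
    refine Real.le_sqrt_of_sq_le ?_
    rw [← Real.exp_nat_mul]
    norm_num
    nlinarith [Real.pi_gt_three, Real.exp_pos 1]
  linarith

lemma step (α β fh c : ℝ) (hα2 : α < 3/2)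
    (hβ : 0 < β) (hfh : 0 < fh) (hc : 0 < c)
    (hc1 : 1 ≤ Real.sqrt (c * (2:ℝ)^((2:ℝ) - α))) (N : ℕ) :
    fG α β fh N - seriesTerm α β fh c (N+1) ≤ fG α β fh (N+1) := by
  have hs := b_ge α c hα2 hc hc1 N
  have hb : 0 < bcoef α (N+1) := by unfold bcoef; positivity
  set q := Real.sqrt (c * bcoef α (N+1)) with hq
  have h1 : q ≤ (⌈q⌉₊ : ℝ) := Nat.le_ceil q
  have h2 : (⌈q⌉₊ : ℝ) ≤ 2 * q := by
    have := Nat.ceil_lt_add_one (by linarith : 0 ≤ q); linarith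
  have hr : 0 < ⌈q⌉₊ := Nat.ceil_pos.2 (by linarith)
  have hr' : (0:ℝ) < ⌈q⌉₊ := by exact_mod_cast hr
  refine le_trans ?_ (aux_step α β fh hβ hfh N ⌈q⌉₊ hr)
  unfold seriesTerm
  rw [← hq]
  have g1 : β * bcoef α (N+1) / (⌈q⌉₊:ℝ) ^ 2 ≤ β / c := by
    have hq2 : q ^ 2 = c * bcoef α (N+1) := Real.sq_sqrt (by positivity)
    calc _ ≤ β * bcoef α (N+1) / q ^ 2 := by gcongr
      _ = _ := by rw [hq2]; field_simp
  have g2 : Real.log ⌈q⌉₊ ≤ Real.log (2 * q) := Real.log_le_log hr' h2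
  have g3 : Real.log (⌈q⌉₊ * Real.exp (1/2)) ≤ Real.log (2 * q * (1 + Real.sqrt (2*Real.pi*Real.exp 1))) := by
    refine Real.log_le_log (by positivity) ?_
    have := exp_half_le
    gcongr
  gcongr

lemma fG_zero (α β fh : ℝ) : fG α β fh 0 = 1 := by
  rw [fG_eq]
  have : ∀ η, phi α β fh 0 η = 1 := by
    intro η
    have hm : ∀ s, mag 0 s ^ 2 = 1 := by
      intro s; unfold mag totalSpin spin
      simp only [pow_zero, div_one]
      haveI : Subsingleton (Fin (2^0)) := by rw [pow_zero]; infer_instance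
      rw [Fintype.sum_subsingleton _ (⟨0, by norm_num⟩ : Fin (2^0))]
      split_ifs <;> norm_num
    unfold phi
    simp only [hm, one_mul]
    exact div_self (Finset.sum_pos (fun _ _ => Real.exp_pos _) Finset.univ_nonempty).ne'
  simp [this]

lemma term_nonneg (α β fh c : ℝ) (hα2 : α < 3/2)
    (hβ : 0 < β) (hfh : 0 < fh) (hc : 0 < c)
    (hc1 : 1 ≤ Real.sqrt (c * (2:ℝ)^((2:ℝ) - α))) (p : ℕ) : 0 ≤ seriesTerm α β fh c (p+1) := by
  have hs := b_ge α c hα2 hc hc1 p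
  have hb : 0 < bcoef α (p+1) := by unfold bcoef; positivity
  unfold seriesTerm
  have l1 := Real.log_nonneg (by linarith : 1 ≤ 2 * Real.sqrt (c * bcoef α (p+1)))
  have l2 := Real.log_nonneg (by nlinarith [Real.sqrt_nonneg (2*Real.pi*Real.exp 1)] : 1 ≤ 2 * Real.sqrt (c * bcoef α (p+1)) * (1 + Real.sqrt (2*Real.pi*Real.exp 1)))
  positivity

lemma partial_bound (α β fh c : ℝ) (hα2 : α < 3/2)
    (hβ : 0 < β) (hfh : 0 < fh) (hc : 0 < c)
    (hc1 : 1 ≤ Real.sqrt (c * (2:ℝ)^((2:ℝ) - α))) (N : ℕ) :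
    1 - ∑ p ∈ Finset.range N, seriesTerm α β fh c (p+1) ≤ fG α β fh N := by
  induction N with
  | zero => simp [fG_zero]
  | succ N ih =>
    rw [Finset.sum_range_succ]
    linarith [step α β fh c hα2 hβ hfh hc hc1 N]

lemma series_hasSum (α β fh c : ℝ) (hα2 : α < 3/2)
    (hβ : 0 < β) (hc : 0 < c) :
    HasSum (fun p : ℕ => seriesTerm α β fh c (p+1))
      ((1/c) * (2:ℝ)^α / ((2:ℝ)^(2:ℕ) - (2:ℝ)^α)
      + fh * (((2:ℝ) - α) * (2:ℝ)^((1:ℝ)/2 + α) / ((2:ℝ)^((3:ℝ)/2) - (2:ℝ)^α)^2 * Real.log 2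
          + (2:ℝ)^α / ((2:ℝ)^((3:ℝ)/2) - (2:ℝ)^α)
            * Real.log (2 * Real.sqrt c * (1 + Real.sqrt (2 * Real.pi * Real.exp 1))))
      + (1/β) * ((2:ℝ)^α / ((2:ℝ)^(2:ℕ) - (2:ℝ)^α) * Real.log (2 * Real.sqrt c)
          + ((2:ℝ) - α) * (2:ℝ)^(1 + α) / ((2:ℝ)^(2:ℕ) - (2:ℝ)^α)^2 * Real.log 2)) := by
  set A := (2:ℝ)^α with hA
  set D := (2:ℝ)^((1:ℝ)/2) with hD
  have hAp : 0 < A := by positivity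
  have hDp : 0 < D := by positivity
  have hD2 : (2:ℝ)^((3:ℝ)/2) = 2 * D := by
    rw [hD, show (3:ℝ)/2 = 1 + 1/2 by norm_num, Real.rpow_add (by norm_num), Real.rpow_one]
  have hDD : D * D = 2 := by
    rw [hD, ← Real.rpow_add (by norm_num)]; norm_num
  have hAD : A < 2 * D := by
    rw [← hD2]; exact Real.rpow_lt_rpow_of_exponent_lt (by norm_num) hα2
  have hA4 : A < 4 := by nlinarith
  have hA1 : (2:ℝ)^((1:ℝ)/2 + α) = D * A := Real.rpow_add (by norm_num) _ _
  have hA2 : (2:ℝ)^(1 + α) = 2 * A := by rw [Real.rpow_add (by norm_num), Real.rpow_one]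
  set x := A / 4 with hx
  set y := A / (2 * D) with hy
  have hx0 : 0 < x := by positivity
  have hy0 : 0 < y := by positivity
  have hx1 : x < 1 := by rw [hx, div_lt_one (by norm_num)]; exact hA4
  have hy1 : y < 1 := by rw [hy, div_lt_one (by positivity)]; exact hAD
  have geo : ∀ z : ℝ, 0 < z → z < 1 → HasSum (fun p : ℕ => z ^ (p+1)) (z / (1 - z)) ∧
      HasSum (fun p : ℕ => ((p:ℝ) + 1) * z ^ (p+1)) (z / (1 - z) ^ 2) := by
    intro z hz0 hz1
    have hn : ‖z‖ < 1 := by rwa [Real.norm_of_nonneg hz0.le]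
    constructor
    · have := (hasSum_geometric_of_lt_one hz0.le hz1).mul_left z
      rw [← div_eq_mul_inv] at this
      exact this.congr_fun fun p => by ring
    · have := hasSum_coe_mul_geometric_of_norm_lt_one hn
      have := (hasSum_nat_add_iff' (f := fun n : ℕ => (n:ℝ) * z ^ n) 1).2 this
      simpa using this
  obtain ⟨gx, gx'⟩ := geo x hx0 hx1
  obtain ⟨gy, gy'⟩ := geo y hy0 hy1
  set S := 1 + Real.sqrt (2 * Real.pi * Real.exp 1) with hS
  have hSp : 0 < S := by positivity
  have hbx : ∀ p : ℕ, bcoef α p = (x ^ p)⁻¹ := by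
    intro p
    rw [bcoef, Real.rpow_mul (by norm_num), Real.rpow_natCast, ← inv_pow]
    congr 1
    rw [Real.rpow_sub (by norm_num), hx, inv_div, ← hA]; norm_num
  have hsq : ∀ p : ℕ, (2:ℝ)^((p:ℝ)/2) = D ^ p := by
    intro p
    rw [hD, ← Real.rpow_natCast, ← Real.rpow_mul (by norm_num)]; congr 1; ring
  have hyx : y = D * x := by
    rw [hy, hx]; field_simp; nlinarith
  have hlog : ∀ p : ℕ, Real.log (Real.sqrt (c * bcoef α p)) = Real.log (Real.sqrt c) + (2 - α) / 2 * p * Real.log 2 := by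
    intro p
    have hb : 0 < bcoef α p := by unfold bcoef; positivity
    rw [Real.log_sqrt (by positivity), Real.log_sqrt hc.le, Real.log_mul hc.ne' hb.ne', bcoef, Real.log_rpow (by norm_num)]
    ring
  have sc : 0 < Real.sqrt c := Real.sqrt_pos.2 hc
  have hterm : ∀ p : ℕ, seriesTerm α β fh c (p+1) =
      (1/c + 1/β * Real.log (2 * Real.sqrt c)) * x ^ (p+1) + (1/β * ((2-α)/2 * Real.log 2)) * (((p:ℝ)+1) * x ^ (p+1))
      + ((fh * Real.log (2 * Real.sqrt c * S)) * y ^ (p+1) + (fh * ((2-α)/2 * Real.log 2)) * (((p:ℝ)+1) * y ^ (p+1))) := by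
    intro p
    have hb : 0 < bcoef α (p+1) := by unfold bcoef; positivity
    have sb : 0 < Real.sqrt (c * bcoef α (p+1)) := by positivity
    unfold seriesTerm
    rw [← hS, Real.log_mul (by positivity) hSp.ne', Real.log_mul (by norm_num) sb.ne', hlog, hsq, hyx, mul_pow, hbx,
      Real.log_mul (x := 2 * Real.sqrt c) (by positivity) hSp.ne', Real.log_mul (by norm_num) sc.ne']
    push_cast
    field_simp
    ring
  have tot := ((gx.mul_left (1/c + 1/β * Real.log (2 * Real.sqrt c))).add (gx'.mul_left (1/β * ((2-α)/2 * Real.log 2)))).add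
    ((gy.mul_left (fh * Real.log (2 * Real.sqrt c * S))).add (gy'.mul_left (fh * ((2-α)/2 * Real.log 2))))
  have val : (1/c + 1/β * Real.log (2 * Real.sqrt c)) * (x / (1 - x)) + (1/β * ((2-α)/2 * Real.log 2)) * (x / (1 - x)^2) +
     ((fh * Real.log (2 * Real.sqrt c * S)) * (y / (1 - y)) + (fh * ((2-α)/2 * Real.log 2)) * (y / (1 - y)^2)) =
     ((1/c) * A / ((2:ℝ)^(2:ℕ) - A)
      + fh * (((2:ℝ) - α) * (2:ℝ)^((1:ℝ)/2 + α) / ((2:ℝ)^((3:ℝ)/2) - A)^2 * Real.log 2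
          + A / ((2:ℝ)^((3:ℝ)/2) - A)
            * Real.log (2 * Real.sqrt c * S))
      + (1/β) * (A / ((2:ℝ)^(2:ℕ) - A) * Real.log (2 * Real.sqrt c)
          + ((2:ℝ) - α) * (2:ℝ)^(1 + α) / ((2:ℝ)^(2:ℕ) - A)^2 * Real.log 2)) := by
    have n4 : (4:ℝ) - A ≠ 0 := by linarith
    have nD : 2 * D - A ≠ 0 := by linarith
    have x1 : x / (1 - x) = A / (4 - A) := by
      have : 1 - x ≠ 0 := by linarith
      rw [div_eq_div_iff this n4, hx]; ring
    have x2 : x / (1 - x) ^ 2 = 4 * A / (4 - A) ^ 2 := by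
      have : 1 - x ≠ 0 := by linarith
      rw [div_eq_div_iff (pow_ne_zero _ this) (pow_ne_zero _ n4), hx]; ring
    have hyD : y * (2 * D) = A := by rw [hy]; field_simp
    have y1 : y / (1 - y) = A / (2 * D - A) := by
      have : 1 - y ≠ 0 := by linarith
      rw [div_eq_div_iff this nD, ← hyD]; ring
    have y2 : y / (1 - y) ^ 2 = 2 * D * A / (2 * D - A) ^ 2 := by
      have : 1 - y ≠ 0 := by linarith
      rw [div_eq_div_iff (pow_ne_zero _ this) (pow_ne_zero _ nD), ← hyD]; ring
    rw [x1, x2, y1, y2, hD2, hA1, hA2]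
    norm_num
    ring
  rw [val] at tot
  exact tot.congr_fun hterm

/-- The series bound for `f_N` (Gaussian random fields, `1 < α < 3/2`,
`1 ≤ (c 2^{2-α})^{1/2}`): the series `Σ_{p≥1}` of error terms converges, `f_N` is
bounded below by `1` minus its sum, and evaluating the sum yields the closed-form
bound of Theorem 1. -/
theorem rfim_dyson_series_bound (α β fh c : ℝ) (hα1 : 1 < α) (hα2 : α < 3/2)
    (hβ : 0 < β) (hfh : 0 < fh) (hc : 0 < c)
    (hc1 : 1 ≤ Real.sqrt (c * (2:ℝ)^((2:ℝ) - α))) :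
    Summable (fun p : ℕ => seriesTerm α β fh c (p+1)) ∧
    (∀ N : ℕ, fG α β fh N ≥ 1 - ∑' p : ℕ, seriesTerm α β fh c (p+1)) ∧
    (∀ N : ℕ, fG α β fh N ≥
      1 - (1/c) * (2:ℝ)^α / ((2:ℝ)^(2:ℕ) - (2:ℝ)^α)
      - fh * (((2:ℝ) - α) * (2:ℝ)^((1:ℝ)/2 + α) / ((2:ℝ)^((3:ℝ)/2) - (2:ℝ)^α)^2 * Real.log 2
          + (2:ℝ)^α / ((2:ℝ)^((3:ℝ)/2) - (2:ℝ)^α)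
            * Real.log (2 * Real.sqrt c * (1 + Real.sqrt (2 * Real.pi * Real.exp 1))))
      - (1/β) * ((2:ℝ)^α / ((2:ℝ)^(2:ℕ) - (2:ℝ)^α) * Real.log (2 * Real.sqrt c)
          + ((2:ℝ) - α) * (2:ℝ)^(1 + α) / ((2:ℝ)^(2:ℕ) - (2:ℝ)^α)^2 * Real.log 2)) := by
  have hs := series_hasSum α β fh c hα2 hβ hc
  have h2 : ∀ N : ℕ, fG α β fh N ≥ 1 - ∑' p : ℕ, seriesTerm α β fh c (p+1) := by
    intro N
    have h1 := partial_bound α β fh c hα2 hβ hfh hc hc1 N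
    have h3 := hs.summable.sum_le_tsum (Finset.range N)
      (fun p _ => term_nonneg α β fh c hα2 hβ hfh hc hc1 p)
    linarith
  refine ⟨hs.summable, h2, fun N => ?_⟩
  have h3 := h2 N
  rw [hs.tsum_eq] at h3
  linarith

end
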